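/- arXiv:1502.04283 — 2 statements merged into one kernel-verified Lean document; each statement's English description precedes it below -/
import Mathlib

section
/- Let b > 3/8 be a real number. There exists a constant C > 0 such that for all families (g_{1,k})_{k∈ℕ} and (g_{2,k})_{k∈ℕ} of measurable functions from ℝ to [0,∞), the following inequality holds in [0,∞]: Σ_{m∈ℕ} (2m+1)^{−1/2} ∫_ℝ ( Σ_{k=0}^{m} (g_{1,k} ⋆ g_{2,m−k})(τ) )² dτ ≤ C · ( Σ_{k∈ℕ} ∫_ℝ ⟨τ − k(k+1)⟩^{2b} g_{1,k}(τ)² dτ ) · ( Σ_{k∈ℕ} (1 + k(k+1))^{1/4} ∫_ℝ ⟨τ − k(k+1)⟩^{2b} g_{2,k}(τ)² dτ ), where (g ⋆ h)(τ) = ∫_ℝ g(τ−σ) h(σ) dσ denotes convolution on ℝ. -/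
open MeasureTheory
open scoped ENNReal

/-- The Japanese bracket `⟨x⟩ = (1 + |x|²)^{1/2}`. -/
noncomputable def jb (x : ℝ) : ℝ := Real.sqrt (1 + x ^ 2)

lemma jb_sq (x : ℝ) : jb x ^ 2 = 1 + x ^ 2 := Real.sq_sqrt (by positivity)

lemma one_le_jb (x : ℝ) : 1 ≤ jb x := Real.one_le_sqrt.2 (by nlinarith [sq_nonneg x])

lemma jb_pos (x : ℝ) : 0 < jb x := one_pos.trans_le (one_le_jb x)

lemma jb_neg (x : ℝ) : jb (-x) = jb x := by simp [jb]

lemma continuous_jb : Continuous jb := by unfold jb; fun_prop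

@[fun_prop]
lemma measurable_jb : Measurable jb := continuous_jb.measurable

lemma jb_add_le (x y : ℝ) : jb (x + y) ≤ jb x + jb y := by
  refine Real.sqrt_le_iff.2 ⟨(add_pos (jb_pos x) (jb_pos y)).le, ?_⟩
  have h : x * y ≤ jb x * jb y := by
    refine le_of_abs_le (abs_le_of_sq_le_sq ?_ (mul_pos (jb_pos x) (jb_pos y)).le)
    rw [mul_pow, mul_pow, jb_sq, jb_sq]
    nlinarith [sq_nonneg x, sq_nonneg y]
  nlinarith [jb_sq x, jb_sq y]

/-- Young-type inequality for products of negative powers. -/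
lemma rpow_neg_mul_rpow_neg_le {x y α β : ℝ} (hx : 0 < x) (hy : 0 < y) (hα : 0 ≤ α)
    (hβ : 0 ≤ β) :
    x ^ (-α) * y ^ (-β) ≤ x ^ (-(α + β)) + y ^ (-(α + β)) := by
  have hx' := Real.rpow_pos_of_pos hx
  have hy' := Real.rpow_pos_of_pos hy
  rw [neg_add]
  rcases le_total x y with h | h
  · have := Real.rpow_le_rpow_of_nonpos hx h (neg_nonpos.2 hβ)
    calc x ^ (-α) * y ^ (-β) ≤ x ^ (-α) * x ^ (-β) := by gcongr
      _ = x ^ (-α + -β) := (Real.rpow_add hx _ _).symm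
      _ ≤ _ := le_add_of_nonneg_right (hy' _).le
  · have := Real.rpow_le_rpow_of_nonpos hy h (neg_nonpos.2 hα)
    calc x ^ (-α) * y ^ (-β) ≤ y ^ (-α) * y ^ (-β) := by gcongr
      _ = y ^ (-α + -β) := (Real.rpow_add hy _ _).symm
      _ ≤ _ := le_add_of_nonneg_left (hx' _).le

/-- Moving a bracket inequality through a negative power. -/
lemma rpow_neg_le_of_le_mul {x y c q : ℝ} (hx : 0 < x) (hy : 0 < y) (hc : 0 < c)
    (hq : 0 ≤ q) (h : x ≤ c * y) : y ^ (-q) ≤ c ^ q * x ^ (-q) := by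
  have := Real.rpow_le_rpow_of_nonpos hx h (neg_nonpos.2 hq)
  rw [Real.mul_rpow hc.le hy.le] at this
  calc y ^ (-q) = c ^ q * (c ^ (-q) * y ^ (-q)) := by
        rw [← mul_assoc, ← Real.rpow_add hc]; simp
    _ ≤ _ := by gcongr

lemma jb_rpow_neg_mul_le_aux {x y p r : ℝ} (hr : 0 ≤ r) (hrp : r ≤ p) (h : jb y ≤ jb x) :
    jb x ^ (-p) * jb y ^ (-p) ≤
      2 ^ (p - r) * jb (x + y) ^ (-(p - r)) * (jb x ^ (-(r + p)) + jb y ^ (-(r + p))) := by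
  have h1 : jb x ^ (-(p - r)) ≤ 2 ^ (p - r) * jb (x + y) ^ (-(p - r)) :=
    rpow_neg_le_of_le_mul (jb_pos _) (jb_pos _) two_pos (by linarith)
      (by linarith [jb_add_le x y])
  have h2 := rpow_neg_mul_rpow_neg_le (jb_pos x) (jb_pos y) hr (hr.trans hrp)
  have h3 : 0 ≤ jb x ^ (-r) * jb y ^ (-p) :=
    mul_nonneg (Real.rpow_nonneg (jb_pos x).le _) (Real.rpow_nonneg (jb_pos y).le _)
  calc jb x ^ (-p) * jb y ^ (-p) = jb x ^ (-(p - r)) * (jb x ^ (-r) * jb y ^ (-p)) := by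
        rw [← mul_assoc, ← Real.rpow_add (jb_pos x)]; ring_nf
    _ ≤ _ := mul_le_mul h1 h2 h3 ((Real.rpow_nonneg (jb_pos x).le _).trans h1)

lemma jb_rpow_neg_mul_le {x y p r : ℝ} (hr : 0 ≤ r) (hrp : r ≤ p) :
    jb x ^ (-p) * jb y ^ (-p) ≤
      2 ^ (p - r) * jb (x + y) ^ (-(p - r)) * (jb x ^ (-(r + p)) + jb y ^ (-(r + p))) := by
  rcases le_total (jb y) (jb x) with h | h
  · exact jb_rpow_neg_mul_le_aux hr hrp h
  · rw [mul_comm (jb x ^ (-p)), add_comm x y, add_comm (jb x ^ _)]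
    exact jb_rpow_neg_mul_le_aux hr hrp h

lemma lintegral_jb_rpow_neg_lt_top {s : ℝ} (hs : 1 < s) :
    ∫⁻ x : ℝ, ENNReal.ofReal (jb x ^ (-s)) < ∞ := by
  have h : Integrable (fun x : ℝ ↦ (1 + ‖x‖ ^ 2) ^ (-s / 2)) :=
    integrable_rpow_neg_one_add_norm_sq (by simpa using hs)
  refine (lintegral_congr fun x ↦ ?_).trans_lt h.lintegral_lt_top
  rw [jb, Real.sqrt_eq_rpow, ← Real.rpow_mul (by positivity)]
  simp only [Real.norm_eq_abs, sq_abs]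
  ring_nf

/-- Convolution estimate for two powers of the bracket. -/
lemma lintegral_jb_rpow_neg_mul_le {p r : ℝ} (hr : 0 ≤ r) (hrp : r ≤ p) (τ a c : ℝ) :
    ∫⁻ σ : ℝ, ENNReal.ofReal (jb (τ - σ - a) ^ (-p) * jb (σ - c) ^ (-p)) ≤
      ENNReal.ofReal (2 ^ (p - r) * jb (τ - a - c) ^ (-(p - r))) *
        (2 * ∫⁻ x : ℝ, ENNReal.ofReal (jb x ^ (-(r + p)))) := by
  have h1 : ∫⁻ σ : ℝ, ENNReal.ofReal (jb (τ - σ - a) ^ (-(r + p))) =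
      ∫⁻ x : ℝ, ENNReal.ofReal (jb x ^ (-(r + p))) := by
    rw [← lintegral_sub_left_eq_self _ (τ - a)]
    exact lintegral_congr fun σ ↦ by ring_nf
  have h2 : ∫⁻ σ : ℝ, ENNReal.ofReal (jb (σ - c) ^ (-(r + p))) =
      ∫⁻ x : ℝ, ENNReal.ofReal (jb x ^ (-(r + p))) :=
    lintegral_sub_right_eq_self (fun x ↦ ENNReal.ofReal (jb x ^ (-(r + p)))) c
  calc _ ≤ ∫⁻ σ : ℝ, ENNReal.ofReal (2 ^ (p - r) * jb (τ - a - c) ^ (-(p - r))) *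
        (ENNReal.ofReal (jb (τ - σ - a) ^ (-(r + p))) +
          ENNReal.ofReal (jb (σ - c) ^ (-(r + p)))) := by
        refine lintegral_mono fun σ ↦ ?_
        have hp := fun x (t : ℝ) ↦ Real.rpow_nonneg (jb_pos x).le t
        rw [← ENNReal.ofReal_add (hp _ _) (hp _ _),
          ← ENNReal.ofReal_mul (mul_nonneg (by positivity) (hp _ _))]
        refine ENNReal.ofReal_le_ofReal ((jb_rpow_neg_mul_le hr hrp).trans_eq ?_)
        rw [show τ - σ - a + (σ - c) = τ - a - c by ring]
    _ = _ := by
        rw [lintegral_const_mul _ (by fun_prop), lintegral_add_left (by fun_prop), h1, h2,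
          two_mul]

lemma tsum_int_jb_rpow_neg_lt_top {s : ℝ} (hs : 1 < s) :
    ∑' n : ℤ, ENNReal.ofReal (jb n ^ (-s)) < ∞ := by
  have h : Summable fun n : ℤ ↦ jb n ^ (-s) := by
    refine .of_norm_bounded_eventually (Real.summable_abs_int_rpow hs) ?_
    filter_upwards [Filter.eventually_cofinite_ne (0 : ℤ)] with n hn
    rw [Real.norm_of_nonneg (Real.rpow_nonneg (jb_pos _).le _)]
    refine Real.rpow_le_rpow_of_nonpos (by positivity) ?_ (by linarith)
    exact Real.abs_le_sqrt (by linarith)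
  rw [lt_top_iff_ne_top]
  exact h.tsum_ofReal_ne_top

/-- Sums of a negative power of the bracket along distinct integers, uniformly in the shift. -/
lemma sum_jb_rpow_neg_le {s : ℝ} (hs : 0 ≤ s) {f : ℕ → ℤ} (hf : f.Injective) (c : ℝ)
    (t : Finset ℕ) :
    ∑ k ∈ t, ENNReal.ofReal (jb (f k - c) ^ (-s)) ≤
      ENNReal.ofReal (3 ^ s) * ∑' n : ℤ, ENNReal.ofReal (jb n ^ (-s)) := by
  have hinj : Function.Injective fun k ↦ f k - ⌊c⌋ := fun i j h ↦ hf (by simpa using h)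
  calc ∑ k ∈ t, ENNReal.ofReal (jb (f k - c) ^ (-s))
      ≤ ∑ k ∈ t, ENNReal.ofReal (3 ^ s) * ENNReal.ofReal (jb ((f k - ⌊c⌋ : ℤ) : ℝ) ^ (-s)) := by
        refine Finset.sum_le_sum fun k _ ↦ ?_
        rw [← ENNReal.ofReal_mul (by positivity)]
        refine ENNReal.ofReal_le_ofReal
          (rpow_neg_le_of_le_mul (jb_pos _) (jb_pos _) three_pos hs ?_)
        have h1 := jb_add_le (f k - c) (Int.fract c)
        have h2 : jb (Int.fract c) ≤ 2 := by
          refine Real.sqrt_le_iff.2 ⟨two_pos.le, ?_⟩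
          nlinarith [Int.fract_nonneg c, Int.fract_lt_one c]
        have h3 : ((f k - ⌊c⌋ : ℤ) : ℝ) = f k - c + Int.fract c := by
          rw [Int.fract]; push_cast; ring
        rw [h3]
        linarith [one_le_jb (f k - c)]
    _ ≤ ∑' k, ENNReal.ofReal (3 ^ s) * ENNReal.ofReal (jb ((f k - ⌊c⌋ : ℤ) : ℝ) ^ (-s)) :=
        ENNReal.sum_le_tsum _
    _ ≤ _ := by
        rw [ENNReal.tsum_mul_left]
        gcongr
        exact ENNReal.tsum_comp_le_tsum_of_injective hinj
          fun n : ℤ ↦ ENNReal.ofReal (jb n ^ (-s))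

/-- The bracket of a quadratic phase dominates the bracket of the distance to its zeros. -/
lemma jb_abs_sub_sqrt_le (T n : ℝ) :
    jb (|n| - √(2 * T)) ≤ 2 * jb (T - n ^ 2 / 2) := by
  set r := √(2 * T) with hr
  have hr0 : 0 ≤ r := Real.sqrt_nonneg _
  have hn := abs_nonneg n
  have key : (|n| - r) ^ 2 ≤ 2 * |T - n ^ 2 / 2| := by
    have hsq := sq_abs n
    rcases le_total 0 T with hT | hT
    · have hrT : r ^ 2 = 2 * T := Real.sq_sqrt (by linarith)
      rcases le_total r |n| with h | h
      · nlinarith [neg_le_abs (T - n ^ 2 / 2)]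
      · nlinarith [le_abs_self (T - n ^ 2 / 2)]
    · have : r = 0 := Real.sqrt_eq_zero_of_nonpos (by linarith)
      rw [this]
      nlinarith [neg_le_abs (T - n ^ 2 / 2)]
  refine Real.sqrt_le_iff.2 ⟨by linarith [jb_pos (T - n ^ 2 / 2)], ?_⟩
  rw [mul_pow, jb_sq, ← sq_abs (T - n ^ 2 / 2)]
  nlinarith [sq_nonneg (|T - n ^ 2 / 2| - 1)]

lemma jb_abs_sub_rpow_le (n r t : ℝ) :
    jb (|n| - r) ^ t ≤ jb (n - r) ^ t + jb (n + r) ^ t := by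
  have h1 := Real.rpow_nonneg (jb_pos (n - r)).le t
  have h2 := Real.rpow_nonneg (jb_pos (n + r)).le t
  rcases abs_cases n with ⟨h, -⟩ | ⟨h, -⟩
  · rw [h]; linarith
  · rw [h, show -n - r = -(n + r) by ring, jb_neg]; linarith

lemma one_add_mul_rpow_neg_le {l : ℝ} (hl : 0 ≤ l) :
    (1 + l * (l + 1)) ^ (-(1 / 4) : ℝ) ≤ jb l ^ (-(1 / 2) : ℝ) := by
  rw [jb, Real.sqrt_eq_rpow, ← Real.rpow_mul (by positivity)]
  norm_num
  exact Real.rpow_le_rpow_of_nonpos (by positivity) (by nlinarith) (by norm_num)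

/-- Pointwise bound on the resonance weight, with `k + l` the total degree. -/
lemma weight_mul_jb_rpow_neg_le {q : ℝ} (hq : 0 ≤ q) (τ k : ℝ) {l : ℝ} (hl : 0 ≤ l) :
    (1 + l * (l + 1)) ^ (-(1 / 4) : ℝ) * jb (τ - k * (k + 1) - l * (l + 1)) ^ (-q) ≤
      2 ^ q * (jb l ^ (-(1 / 2 + q)) +
        (jb (k - l - √(2 * (τ - (k + l) - (k + l) ^ 2 / 2))) ^ (-(1 / 2 + q)) +
          jb (k - l + √(2 * (τ - (k + l) - (k + l) ^ 2 / 2))) ^ (-(1 / 2 + q)))) := by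
  set T := τ - (k + l) - (k + l) ^ 2 / 2 with hT
  have hp := fun x (t : ℝ) ↦ Real.rpow_nonneg (jb_pos x).le t
  have h0 : τ - k * (k + 1) - l * (l + 1) = T - (k - l) ^ 2 / 2 := by rw [hT]; ring
  have h1 : jb (T - (k - l) ^ 2 / 2) ^ (-q) ≤ 2 ^ q * jb (|k - l| - √(2 * T)) ^ (-q) :=
    rpow_neg_le_of_le_mul (jb_pos _) (jb_pos _) two_pos hq (jb_abs_sub_sqrt_le T (k - l))
  rw [h0]
  calc _ ≤ jb l ^ (-(1 / 2) : ℝ) * (2 ^ q * jb (|k - l| - √(2 * T)) ^ (-q)) :=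
        mul_le_mul (one_add_mul_rpow_neg_le hl) h1 (hp _ _) (hp _ _)
    _ = 2 ^ q * (jb l ^ (-(1 / 2) : ℝ) * jb (|k - l| - √(2 * T)) ^ (-q)) := by ring
    _ ≤ 2 ^ q * (jb l ^ (-(1 / 2 + q)) + jb (|k - l| - √(2 * T)) ^ (-(1 / 2 + q))) := by
        gcongr
        exact rpow_neg_mul_rpow_neg_le (jb_pos _) (jb_pos _) (by norm_num) hq
    _ ≤ _ := by
        gcongr
        exact jb_abs_sub_rpow_le _ _ _

/-- Uniform bound on the weighted sum over the resonances of total degree `m`. -/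
lemma sum_weight_mul_jb_rpow_neg_le {q : ℝ} (hq : 0 ≤ q) (m : ℕ) (τ : ℝ) :
    ∑ k ∈ Finset.range (m + 1), ENNReal.ofReal
      ((1 + ((m - k : ℕ) : ℝ) * (((m - k : ℕ) : ℝ) + 1)) ^ (-(1 / 4) : ℝ) *
        jb (τ - (k : ℝ) * ((k : ℝ) + 1) -
          ((m - k : ℕ) : ℝ) * (((m - k : ℕ) : ℝ) + 1)) ^ (-q)) ≤
      ENNReal.ofReal (2 ^ q) * (3 * (ENNReal.ofReal (3 ^ (1 / 2 + q)) *
        ∑' n : ℤ, ENNReal.ofReal (jb n ^ (-(1 / 2 + q))))) := by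
  set T : ℝ := τ - m - (m : ℝ) ^ 2 / 2 with hT
  have hp := fun x (t : ℝ) ↦ Real.rpow_nonneg (jb_pos x).le t
  have hs : 0 ≤ 1 / 2 + q := by positivity
  have hf1 : Function.Injective fun k : ℕ ↦ (k : ℤ) := Nat.cast_injective
  have hf2 : Function.Injective fun k : ℕ ↦ 2 * (k : ℤ) - m := fun i j h ↦ by
    simp only at h; omega
  calc _ ≤ ∑ k ∈ Finset.range (m + 1), ENNReal.ofReal (2 ^ q) *
        (ENNReal.ofReal (jb (((k : ℤ) : ℝ) - m) ^ (-(1 / 2 + q))) +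
          (ENNReal.ofReal (jb (((2 * (k : ℤ) - m : ℤ) : ℝ) - √(2 * T)) ^ (-(1 / 2 + q))) +
          ENNReal.ofReal (jb (((2 * (k : ℤ) - m : ℤ) : ℝ) - -√(2 * T)) ^ (-(1 / 2 + q))))) := by
        refine Finset.sum_le_sum fun k hk ↦ ?_
        have hkm : k ≤ m := Nat.lt_succ_iff.1 (Finset.mem_range.1 hk)
        rw [← ENNReal.ofReal_add (hp _ _) (hp _ _),
          ← ENNReal.ofReal_add (hp _ _) (add_nonneg (hp _ _) (hp _ _)),
          ← ENNReal.ofReal_mul (by positivity)]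
        refine ENNReal.ofReal_le_ofReal
          ((weight_mul_jb_rpow_neg_le hq τ k (Nat.cast_nonneg (m - k))).trans_eq ?_)
        have h1 : (((k : ℤ) : ℝ) - m) = -(m - k) := by push_cast; ring
        rw [h1, jb_neg, Nat.cast_sub hkm, add_sub_cancel, ← hT]
        push_cast
        ring_nf
    _ ≤ _ := by
        rw [← Finset.mul_sum, Finset.sum_add_distrib, Finset.sum_add_distrib]
        gcongr
        refine (add_le_add (sum_jb_rpow_neg_le hs hf1 m _)
          (add_le_add (sum_jb_rpow_neg_le hs hf2 (√(2 * T)) _)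
            (sum_jb_rpow_neg_le hs hf2 (-√(2 * T)) _))).trans_eq ?_
        ring

/-- Cauchy–Schwarz for a finite sum of integrals. -/
lemma sq_sum_lintegral_mul_le {ι α : Type*} [MeasurableSpace α] (μ : Measure α)
    (t : Finset ι) {u v : ι → α → ℝ≥0∞} (hu : ∀ i, AEMeasurable (u i) μ)
    (hv : ∀ i, AEMeasurable (v i) μ) :
    (∑ i ∈ t, ∫⁻ x, u i x * v i x ∂μ) ^ 2 ≤
      (∑ i ∈ t, ∫⁻ x, u i x ^ 2 ∂μ) * ∑ i ∈ t, ∫⁻ x, v i x ^ 2 ∂μ := by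
  have h2 : (2 : ℝ).HolderConjugate 2 := Real.HolderConjugate.two_two
  have hpow : ∀ x : ℝ≥0∞, (x ^ (1 / 2 : ℝ)) ^ (2 : ℕ) = x := fun x ↦ by
    rw [← ENNReal.rpow_natCast, ← ENNReal.rpow_mul]; norm_num
  have hpow' : ∀ x : ℝ≥0∞, (x ^ (1 / 2 : ℝ)) ^ (2 : ℝ) = x := fun x ↦ by
    rw [← ENNReal.rpow_mul]; norm_num
  calc _ ≤ (∑ i ∈ t, (∫⁻ x, u i x ^ 2 ∂μ) ^ (1 / 2 : ℝ) *
        (∫⁻ x, v i x ^ 2 ∂μ) ^ (1 / 2 : ℝ)) ^ 2 := by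
        gcongr with i
        simpa using ENNReal.lintegral_mul_le_Lp_mul_Lq μ h2 (hu i) (hv i)
    _ ≤ ((∑ i ∈ t, ∫⁻ x, u i x ^ 2 ∂μ) ^ (1 / 2 : ℝ) *
        (∑ i ∈ t, ∫⁻ x, v i x ^ 2 ∂μ) ^ (1 / 2 : ℝ)) ^ 2 := by
        gcongr
        simpa only [hpow'] using ENNReal.inner_le_Lp_mul_Lq t
          (fun i ↦ (∫⁻ x, u i x ^ 2 ∂μ) ^ (1 / 2 : ℝ))
          (fun i ↦ (∫⁻ x, v i x ^ 2 ∂μ) ^ (1 / 2 : ℝ)) h2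
    _ = _ := by rw [mul_pow, hpow, hpow]

/-- Uniform bound for the Schur-type kernel of the bilinear estimate. -/
lemma exists_sum_lintegral_kernel_le {b : ℝ} (hb : 3 / 8 < b) :
    ∃ K : ℝ≥0∞, K ≠ ∞ ∧ ∀ (m : ℕ) (τ : ℝ), ∑ k ∈ Finset.range (m + 1), ∫⁻ σ : ℝ,
      ENNReal.ofReal ((1 + ((m - k : ℕ) : ℝ) * (((m - k : ℕ) : ℝ) + 1)) ^ (-(1 / 4) : ℝ) *
        (jb (τ - σ - (k : ℝ) * ((k : ℝ) + 1)) ^ (-(2 * b)) *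
          jb (σ - ((m - k : ℕ) : ℝ) * (((m - k : ℕ) : ℝ) + 1)) ^ (-(2 * b)))) ≤ K := by
  set q := 2 * b - 1 / 4 with hq
  have hI := lintegral_jb_rpow_neg_lt_top (s := 1 / 4 + 2 * b) (by linarith)
  have hS := tsum_int_jb_rpow_neg_lt_top (s := 1 / 2 + q) (by linarith)
  set I := ∫⁻ x : ℝ, ENNReal.ofReal (jb x ^ (-(1 / 4 + 2 * b)))
  set S := ∑' n : ℤ, ENNReal.ofReal (jb n ^ (-(1 / 2 + q)))
  refine ⟨ENNReal.ofReal (2 ^ q) * (2 * I) *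
    (ENNReal.ofReal (2 ^ q) * (3 * (ENNReal.ofReal (3 ^ (1 / 2 + q)) * S))), ?_, ?_⟩
  · have := hI.ne
    have := hS.ne
    finiteness
  intro m τ
  refine le_trans ?_ (mul_le_mul_right
    (sum_weight_mul_jb_rpow_neg_le (q := q) (by linarith) m τ) _)
  rw [Finset.mul_sum]
  refine Finset.sum_le_sum fun k _ ↦ ?_
  set l : ℝ := ((m - k : ℕ) : ℝ)
  have hl : 0 ≤ (1 + l * (l + 1)) ^ (-(1 / 4) : ℝ) := by positivity
  simp only [ENNReal.ofReal_mul hl]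
  rw [lintegral_const_mul _ (by fun_prop)]
  refine (mul_le_mul_right (lintegral_jb_rpow_neg_mul_le (r := 1 / 4) (by norm_num)
    (by linarith) τ _ _) _).trans_eq ?_
  rw [ENNReal.ofReal_mul (by positivity)]
  ring

/-- The Cauchy product formula for series of extended nonnegative reals. -/
lemma ENNReal.tsum_sum_range_mul (f g : ℕ → ℝ≥0∞) :
    ∑' m, ∑ k ∈ Finset.range (m + 1), f k * g (m - k) = (∑' k, f k) * ∑' k, g k := by
  simp_rw [← Finset.Nat.sum_antidiagonal_eq_sum_range_succ fun i j ↦ f i * g j,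
    ← ENNReal.tsum_mul_right, ← ENNReal.tsum_mul_left]
  rw [← ENNReal.tsum_prod (f := fun i j ↦ f i * g j),
    ← Finset.HasAntidiagonal.sigmaAntidiagonalEquivProd.tsum_eq, ENNReal.tsum_sigma']
  refine tsum_congr fun m ↦ ?_
  rw [tsum_fintype, ← Finset.sum_coe_sort]
  rfl

lemma lintegral_lintegral_sub_mul {F G : ℝ → ℝ≥0∞} (hF : Measurable F) (hG : Measurable G) :
    ∫⁻ τ, ∫⁻ σ, F (τ - σ) * G σ = (∫⁻ x, F x) * ∫⁻ x, G x := by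
  rw [lintegral_lintegral_swap (by fun_prop), ← lintegral_const_mul _ hG]
  refine lintegral_congr fun σ ↦ ?_
  rw [lintegral_mul_const _ (by fun_prop), lintegral_sub_right_eq_self F σ]

/-- Cauchy–Schwarz against the Schur-type kernel, at fixed total degree and frequency. -/
lemma sq_sum_convolution_le {b : ℝ} {K : ℝ≥0∞} (m : ℕ) (τ : ℝ)
    (hK : ∑ k ∈ Finset.range (m + 1), ∫⁻ σ : ℝ,
      ENNReal.ofReal ((1 + ((m - k : ℕ) : ℝ) * (((m - k : ℕ) : ℝ) + 1)) ^ (-(1 / 4) : ℝ) *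
        (jb (τ - σ - (k : ℝ) * ((k : ℝ) + 1)) ^ (-(2 * b)) *
          jb (σ - ((m - k : ℕ) : ℝ) * (((m - k : ℕ) : ℝ) + 1)) ^ (-(2 * b)))) ≤ K)
    {g₁ g₂ : ℕ → ℝ → ℝ} (hm₁ : ∀ k, Measurable (g₁ k)) (hm₂ : ∀ k, Measurable (g₂ k))
    (h₁ : ∀ k τ, 0 ≤ g₁ k τ) (h₂ : ∀ k τ, 0 ≤ g₂ k τ) :
    (∑ k ∈ Finset.range (m + 1),
      ∫⁻ σ : ℝ, ENNReal.ofReal (g₁ k (τ - σ)) * ENNReal.ofReal (g₂ (m - k) σ)) ^ 2 ≤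
    K * ∑ k ∈ Finset.range (m + 1), ∫⁻ σ : ℝ,
      (ENNReal.ofReal (jb (τ - σ - (k : ℝ) * ((k : ℝ) + 1)) ^ (2 * b)) *
        ENNReal.ofReal (g₁ k (τ - σ) ^ 2)) *
      (ENNReal.ofReal ((1 + ((m - k : ℕ) : ℝ) * (((m - k : ℕ) : ℝ) + 1)) ^ ((1 : ℝ) / 4)) *
        (ENNReal.ofReal (jb (σ - ((m - k : ℕ) : ℝ) * (((m - k : ℕ) : ℝ) + 1)) ^ (2 * b)) *
          ENNReal.ofReal (g₂ (m - k) σ ^ 2))) := by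
  have hsq : ∀ {x : ℝ} (t : ℝ), 0 < x → (x ^ t) ^ 2 = x ^ (2 * t) := fun t hx ↦ by
    rw [← Real.rpow_natCast, ← Real.rpow_mul hx.le]; push_cast; ring_nf
  have hinv : ∀ {x : ℝ} (t : ℝ), 0 < x → x ^ (-t) * x ^ t = 1 := fun t hx ↦ by
    rw [← Real.rpow_add hx]; simp
  have hp := fun x (t : ℝ) ↦ Real.rpow_nonneg (jb_pos x).le t
  set w : ℕ → ℝ := fun k ↦ 1 + ((m - k : ℕ) : ℝ) * (((m - k : ℕ) : ℝ) + 1) with hw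
  have hw0 : ∀ k, 0 < w k := fun k ↦ by simp only [hw]; positivity
  set X : ℕ → ℝ → ℝ := fun k σ ↦ jb (τ - σ - (k : ℝ) * ((k : ℝ) + 1)) with hX
  set Y : ℕ → ℝ → ℝ := fun k σ ↦
    jb (σ - ((m - k : ℕ) : ℝ) * (((m - k : ℕ) : ℝ) + 1)) with hY
  have hX0 : ∀ k σ, 0 < X k σ := fun k σ ↦ jb_pos _
  have hY0 : ∀ k σ, 0 < Y k σ := fun k σ ↦ jb_pos _
  have hXm : ∀ k, Measurable (X k) := fun k ↦ by simp only [hX]; fun_prop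
  have hYm : ∀ k, Measurable (Y k) := fun k ↦ by simp only [hY]; fun_prop
  set u : ℕ → ℝ → ℝ≥0∞ := fun k σ ↦
    ENNReal.ofReal (w k ^ (-(1 / 8) : ℝ) * (X k σ ^ (-b) * Y k σ ^ (-b))) with hu
  set v : ℕ → ℝ → ℝ≥0∞ := fun k σ ↦ ENNReal.ofReal
    ((X k σ ^ b * g₁ k (τ - σ)) * (w k ^ (1 / 8 : ℝ) * (Y k σ ^ b * g₂ (m - k) σ))) with hv
  have huv : ∀ k σ, ENNReal.ofReal (g₁ k (τ - σ)) * ENNReal.ofReal (g₂ (m - k) σ) =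
      u k σ * v k σ := fun k σ ↦ by
    have := hX0 k σ
    have := hY0 k σ
    have := hw0 k
    rw [hu, hv, ← ENNReal.ofReal_mul (h₁ _ _), ← ENNReal.ofReal_mul (by positivity)]
    congr 1
    calc _ = (w k ^ (-(1 / 8) : ℝ) * w k ^ (1 / 8 : ℝ)) * (X k σ ^ (-b) * X k σ ^ b) *
          (Y k σ ^ (-b) * Y k σ ^ b) * (g₁ k (τ - σ) * g₂ (m - k) σ) := by
          rw [hinv _ (hw0 k), hinv _ (hX0 k σ), hinv _ (hY0 k σ)]; ring
      _ = _ := by ring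
  have hu2 : ∀ k σ, u k σ ^ 2 = ENNReal.ofReal
      (w k ^ (-(1 / 4) : ℝ) * (X k σ ^ (-(2 * b)) * Y k σ ^ (-(2 * b)))) := fun k σ ↦ by
    have := hX0 k σ
    have := hY0 k σ
    have := hw0 k
    rw [hu, ← ENNReal.ofReal_pow (by positivity), mul_pow, mul_pow, hsq _ (hw0 k),
      hsq _ (hX0 k σ), hsq _ (hY0 k σ)]
    ring_nf
  have hv2 : ∀ k σ, v k σ ^ 2 =
      (ENNReal.ofReal (X k σ ^ (2 * b)) * ENNReal.ofReal (g₁ k (τ - σ) ^ 2)) *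
      (ENNReal.ofReal (w k ^ ((1 : ℝ) / 4)) * (ENNReal.ofReal (Y k σ ^ (2 * b)) *
        ENNReal.ofReal (g₂ (m - k) σ ^ 2))) := fun k σ ↦ by
    have := hX0 k σ
    have := hY0 k σ
    have := hw0 k
    have := h₁ k (τ - σ)
    have := h₂ (m - k) σ
    rw [hv, ← ENNReal.ofReal_pow (by positivity), ← ENNReal.ofReal_mul (by positivity),
      ← ENNReal.ofReal_mul (by positivity), ← ENNReal.ofReal_mul (by positivity),
      ← ENNReal.ofReal_mul (by positivity)]
    simp only [mul_pow]
    rw [hsq _ (hw0 k), hsq _ (hX0 k σ), hsq _ (hY0 k σ)]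
    norm_num
  have hCS := sq_sum_lintegral_mul_le volume (Finset.range (m + 1)) (u := u) (v := v)
    (fun k ↦ by have := hXm k; have := hYm k; simp only [hu]; fun_prop)
    (fun k ↦ by
      have := hXm k; have := hYm k; have := hm₁ k; have := hm₂ (m - k)
      simp only [hv]; fun_prop)
  simp only [hu2, hv2, ← huv] at hCS
  exact hCS.trans (mul_le_mul_left hK _)

/-- The analytic core of the bilinear Strichartz estimate on `S²`: for `b > 3/8` there
is `C > 0` such that, for all families `g₁, g₂` of nonnegative measurable functions,
`Σ_m (2m+1)^{−1/2} ∫ (Σ_{k≤m} (g_{1,k} ⋆ g_{2,m−k})(τ))² dτ` is bounded by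
`C (Σ_k ∫ ⟨τ−k(k+1)⟩^{2b} g_{1,k}²) (Σ_k (1+k(k+1))^{1/4} ∫ ⟨τ−k(k+1)⟩^{2b} g_{2,k}²)`. -/
theorem bilinear_strichartz_core (b : ℝ) (hb : 3 / 8 < b) :
    ∃ C : ℝ, 0 < C ∧ ∀ g₁ g₂ : ℕ → ℝ → ℝ,
      (∀ k, Measurable (g₁ k)) → (∀ k, Measurable (g₂ k)) →
      (∀ k τ, 0 ≤ g₁ k τ) → (∀ k τ, 0 ≤ g₂ k τ) →
      ∑' m : ℕ, ENNReal.ofReal ((2 * (m : ℝ) + 1) ^ (-(1 : ℝ) / 2)) *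
          ∫⁻ τ : ℝ,
            (∑ k ∈ Finset.range (m + 1),
              ∫⁻ σ : ℝ, ENNReal.ofReal (g₁ k (τ - σ)) * ENNReal.ofReal (g₂ (m - k) σ)) ^ 2 ≤
        ENNReal.ofReal C *
          (∑' k : ℕ, ∫⁻ τ : ℝ,
              ENNReal.ofReal (jb (τ - (k : ℝ) * ((k : ℝ) + 1)) ^ (2 * b)) *
                ENNReal.ofReal (g₁ k τ ^ 2)) *
          (∑' k : ℕ, ENNReal.ofReal ((1 + (k : ℝ) * ((k : ℝ) + 1)) ^ ((1 : ℝ) / 4)) *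
            ∫⁻ τ : ℝ,
              ENNReal.ofReal (jb (τ - (k : ℝ) * ((k : ℝ) + 1)) ^ (2 * b)) *
                ENNReal.ofReal (g₂ k τ ^ 2)) := by
  obtain ⟨K, hK, hker⟩ := exists_sum_lintegral_kernel_le hb
  refine ⟨K.toReal + 1, by positivity, fun g₁ g₂ hm₁ hm₂ h₁ h₂ ↦ ?_⟩
  have hKC : K ≤ ENNReal.ofReal (K.toReal + 1) := by
    rw [ENNReal.le_ofReal_iff_toReal_le hK (by positivity)]
    linarith
  set F : ℕ → ℝ → ℝ≥0∞ := fun k τ ↦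
    ENNReal.ofReal (jb (τ - (k : ℝ) * ((k : ℝ) + 1)) ^ (2 * b)) *
      ENNReal.ofReal (g₁ k τ ^ 2) with hF
  set G : ℕ → ℝ → ℝ≥0∞ := fun k τ ↦
    ENNReal.ofReal ((1 + (k : ℝ) * ((k : ℝ) + 1)) ^ ((1 : ℝ) / 4)) *
      (ENNReal.ofReal (jb (τ - (k : ℝ) * ((k : ℝ) + 1)) ^ (2 * b)) *
        ENNReal.ofReal (g₂ k τ ^ 2)) with hG
  have hFm : ∀ k, Measurable (F k) := fun k ↦ by
    have := hm₁ k; simp only [hF]; fun_prop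
  have hGm : ∀ k, Measurable (G k) := fun k ↦ by
    have := hm₂ k; simp only [hG]; fun_prop
  calc _ ≤ ∑' m : ℕ, K * ∑ k ∈ Finset.range (m + 1),
        (∫⁻ x, F k x) * ∫⁻ x, G (m - k) x := by
        refine ENNReal.tsum_le_tsum fun m ↦ ?_
        have hw : ENNReal.ofReal ((2 * (m : ℝ) + 1) ^ (-(1 : ℝ) / 2)) ≤ 1 := by
          rw [ENNReal.ofReal_le_one]
          exact Real.rpow_le_one_of_one_le_of_nonpos (by simp) (by norm_num)
        refine (mul_le_of_le_one_left zero_le hw).trans ?_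
        refine (lintegral_mono fun τ ↦
          sq_sum_convolution_le m τ (hker m τ) hm₁ hm₂ h₁ h₂).trans_eq ?_
        rw [lintegral_const_mul' _ _ hK]
        congr 1
        have hmeas : ∀ k, Measurable fun τ ↦ ∫⁻ σ, F k (τ - σ) * G (m - k) σ := fun k ↦ by
          have := hFm k
          have := hGm (m - k)
          exact Measurable.lintegral_prod_right (by fun_prop)
        refine (lintegral_finsetSum _ fun k _ ↦ hmeas k).trans ?_
        exact Finset.sum_congr rfl fun k _ ↦ lintegral_lintegral_sub_mul (hFm k) (hGm (m - k))
    _ = K * ((∑' k, ∫⁻ x, F k x) * ∑' k, ∫⁻ x, G k x) := by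
        rw [ENNReal.tsum_mul_left, ENNReal.tsum_sum_range_mul (fun k ↦ ∫⁻ x, F k x)
          fun k ↦ ∫⁻ x, G k x]
    _ ≤ _ := by
        rw [← mul_assoc]
        simp only [hG, lintegral_const_mul' _ _ ENNReal.ofReal_ne_top]
        gcongr
end

section
/- For every real number p with 2 ≤ p ≤ 6 there exists a constant c > 0 such that for every natural number k ≥ 1, the function ψ̃_k(x) = (x₁ + i x₂)^k on S² satisfies ‖ψ̃_k‖_{L^p(S²)} ≥ c · (1+k)^{(p−2)/(4p)} · ‖ψ̃_k‖_{L²(S²)}. In other words, the family of highest-weight spherical harmonics saturates the exponent (p−2)/(4p) in Sogge's L^p eigenfunction estimate for 2 ≤ p ≤ 6. -/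
open MeasureTheory Metric

/-- The standard surface measure on the unit sphere `S² ⊆ ℝ³`. -/
noncomputable def sphereMeasure : Measure (sphere (0 : EuclideanSpace ℝ (Fin 3)) 1) :=
  (volume : Measure (EuclideanSpace ℝ (Fin 3))).toSphere

/-- The highest-weight spherical harmonic `ψ̃_k(x) = (x₁+ix₂)^k` on `S²`. -/
noncomputable def psiTilde (k : ℕ) (x : sphere (0 : EuclideanSpace ℝ (Fin 3)) 1) : ℂ :=
  (((x : EuclideanSpace ℝ (Fin 3)) 0 : ℂ) + Complex.I * ((x : EuclideanSpace ℝ (Fin 3)) 1)) ^ k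

open Real Set

/-- The distance from a point of `ℝ³` to the third coordinate axis. -/
noncomputable def axisDist (x : EuclideanSpace ℝ (Fin 3)) : ℝ :=
  ‖(x 0 : ℂ) + Complex.I * (x 1 : ℂ)‖

lemma axisDist_smul {r : ℝ} (hr : 0 ≤ r) (x : EuclideanSpace ℝ (Fin 3)) :
    axisDist (r • x) = r * axisDist x := by
  have h : ((r • x) 0 : ℂ) + Complex.I * ((r • x) 1 : ℂ) =
      (r : ℂ) * ((x 0 : ℂ) + Complex.I * (x 1 : ℂ)) := by
    simp only [PiLp.smul_apply, smul_eq_mul, Complex.ofReal_mul]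
    ring
  rw [axisDist, h, norm_mul, Complex.norm_real, Real.norm_of_nonneg hr, axisDist]

lemma axisDist_sq (x : EuclideanSpace ℝ (Fin 3)) : axisDist x ^ 2 = x 0 ^ 2 + x 1 ^ 2 := by
  rw [axisDist, mul_comm, Complex.norm_add_mul_I, sq_sqrt (by positivity)]

lemma norm_sq_eq_axisDist_sq_add (x : EuclideanSpace ℝ (Fin 3)) :
    ‖x‖ ^ 2 = x 2 ^ 2 + axisDist x ^ 2 := by
  rw [EuclideanSpace.real_norm_sq_eq, Fin.sum_univ_three, axisDist_sq]
  ring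

lemma axisDist_nonneg (x : EuclideanSpace ℝ (Fin 3)) : 0 ≤ axisDist x := norm_nonneg _

lemma axisDist_le_one (x : sphere (0 : EuclideanSpace ℝ (Fin 3)) 1) : axisDist x ≤ 1 := by
  have h := norm_sq_eq_axisDist_sq_add x
  rw [norm_eq_of_mem_sphere] at h
  nlinarith [sq_nonneg ((x : EuclideanSpace ℝ (Fin 3)) 2), axisDist_nonneg x]

/-- Cartesian evaluation of the Gaussian moments of the distance to an axis. -/
lemma integral_axisDist_pow_mul_exp (m : ℕ) :
    ∫ x : EuclideanSpace ℝ (Fin 3), axisDist x ^ m * exp (-‖x‖ ^ 2) =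
      √π * (π * Gamma ((m + 2) / 2)) := by
  let e : EuclideanSpace ℝ (Fin 3) ≃ᵐ ℝ × ℂ :=
    (MeasurableEquiv.toLp 2 (Fin 3 → ℝ)).symm.trans
      ((MeasurableEquiv.piFinSuccAbove (fun _ : Fin 3 => ℝ) 2).trans
        ((MeasurableEquiv.refl ℝ).prodCongr Complex.measurableEquivPi.symm))
  have he : MeasurePreserving e volume volume :=
    (((MeasurePreserving.id volume).prod Complex.volume_preserving_equiv_pi.symm).comp
      (volume_preserving_piFinSuccAbove (fun _ : Fin 3 => ℝ) 2)).comp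
      (EuclideanSpace.volume_preserving_symm_measurableEquiv_toLp (Fin 3))
  have he1 (x : EuclideanSpace ℝ (Fin 3)) : (e x).1 = x 2 := rfl
  have he2 (x : EuclideanSpace ℝ (Fin 3)) : ‖(e x).2‖ = axisDist x := by
    rw [axisDist, mul_comm]
    rfl
  have hR : ∫ t : ℝ, exp (-t ^ 2) = √π := by
    simpa using integral_gaussian 1
  have hC : ∫ z : ℂ, ‖z‖ ^ m * exp (-‖z‖ ^ 2) = π * Gamma ((m + 2) / 2) := by
    have hm : (-2 : ℝ) < m := by linarith [(Nat.cast_nonneg m : (0 : ℝ) ≤ m)]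
    have h := Complex.integral_rpow_mul_exp_neg_rpow (p := 2) (q := m) one_le_two hm
    simp only [rpow_natCast, rpow_two] at h
    rw [h]
    ring
  rw [← hC, ← hR, ← integral_prod_mul, ← Measure.volume_eq_prod,
    ← he.integral_comp e.measurableEmbedding]
  refine integral_congr_ae (.of_forall fun x => ?_)
  simp only [he1, he2, norm_sq_eq_axisDist_sq_add x]
  rw [neg_add, exp_add]
  ring

/-- Polar evaluation of the Gaussian moments of the distance to an axis. -/
lemma integral_axisDist_pow_mul_exp_eq_sphere (m : ℕ) :
    ∫ x : EuclideanSpace ℝ (Fin 3), axisDist x ^ m * exp (-‖x‖ ^ 2) =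
      (∫ s, axisDist s ^ m ∂sphereMeasure) * (1 / 2 * Gamma ((m + 3) / 2)) := by
  have hdim : Module.finrank ℝ (EuclideanSpace ℝ (Fin 3)) - 1 = 2 := by simp
  have hrad : ∫ r : Ioi (0 : ℝ), (r : ℝ) ^ m * exp (-(r : ℝ) ^ 2) ∂Measure.volumeIoiPow 2 =
      1 / 2 * Gamma ((m + 3) / 2) := by
    have hm : (-1 : ℝ) < (m + 2 : ℕ) := by
      linarith [(Nat.cast_nonneg (m + 2) : (0 : ℝ) ≤ (m + 2 : ℕ))]
    have h := integral_rpow_mul_exp_neg_rpow (p := 2) (q := (m + 2 : ℕ)) two_pos hm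
    simp only [rpow_natCast, rpow_two] at h
    rw [show ((m : ℝ) + 3) / 2 = ((m + 2 : ℕ) + 1) / 2 by push_cast; ring, ← h]
    simp only [Measure.volumeIoiPow, ENNReal.ofReal]
    rw [integral_withDensity_eq_integral_smul,
      integral_subtype_comap measurableSet_Ioi
        fun a : ℝ => Real.toNNReal (a ^ 2) • (a ^ m * exp (-a ^ 2)),
      setIntegral_congr_fun measurableSet_Ioi fun x hx => ?_]
    · simp only [NNReal.smul_def, Real.coe_toNNReal _ (sq_nonneg x), smul_eq_mul]
      ring
    · exact (measurable_subtype_coe.pow_const _).real_toNNReal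
  let μ : Measure (EuclideanSpace ℝ (Fin 3)) := volume
  have hpol := μ.measurePreserving_homeomorphUnitSphereProd
  rw [hdim] at hpol
  calc
    _ = ∫ x : ({(0)}ᶜ : Set (EuclideanSpace ℝ (Fin 3))),
        axisDist x ^ m * exp (-‖(x : EuclideanSpace ℝ (Fin 3))‖ ^ 2) ∂(μ.comap (↑)) := by
      rw [integral_subtype_comap (measurableSet_singleton _).compl
        fun x => axisDist x ^ m * exp (-‖x‖ ^ 2), restrict_compl_singleton]
    _ = ∫ x, axisDist x.1 ^ m * ((x.2 : ℝ) ^ m * exp (-(x.2 : ℝ) ^ 2))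
        ∂μ.toSphere.prod (.volumeIoiPow 2) := by
      rw [← hpol.integral_comp (Homeomorph.measurableEmbedding _)]
      refine integral_congr_ae (.of_forall fun x => ?_)
      simp only [homeomorphUnitSphereProd_apply_fst_coe, homeomorphUnitSphereProd_apply_snd_coe]
      have hx : ‖(x : EuclideanSpace ℝ (Fin 3))‖ ≠ 0 := norm_ne_zero_iff.2 x.2
      rw [axisDist_smul (by positivity), ← mul_assoc, ← mul_pow]
      congr 2
      field_simp
    _ = _ := by
      rw [integral_prod_mul (fun s : sphere (0 : EuclideanSpace ℝ (Fin 3)) 1 => axisDist s ^ m)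
        fun r : Ioi (0 : ℝ) => (r : ℝ) ^ m * exp (-(r : ℝ) ^ 2), hrad]
      rfl

/-- The integral of `axisDist ^ m` over the sphere. -/
noncomputable def sphereMoment (m : ℕ) : ℝ := ∫ s, axisDist s ^ m ∂sphereMeasure

lemma sphereMoment_mul_Gamma (m : ℕ) :
    sphereMoment m * (1 / 2 * Gamma ((m + 3) / 2)) = √π * (π * Gamma ((m + 2) / 2)) := by
  rw [sphereMoment, ← integral_axisDist_pow_mul_exp_eq_sphere, integral_axisDist_pow_mul_exp]

lemma sphereMoment_pos (m : ℕ) : 0 < sphereMoment m := by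
  have h : 0 < √π * (π * Gamma ((m + 2) / 2)) := by
    have := Gamma_pos_of_pos (s := ((m : ℝ) + 2) / 2) (by positivity)
    have := pi_pos
    positivity
  rw [← sphereMoment_mul_Gamma] at h
  have := Gamma_pos_of_pos (s := ((m : ℝ) + 3) / 2) (by positivity)
  exact pos_of_mul_pos_left h (by positivity)

lemma sphereMoment_add_two (m : ℕ) :
    sphereMoment (m + 2) * (m + 3) = sphereMoment m * (m + 2) := by
  have h0 := sphereMoment_mul_Gamma m
  have h2 := sphereMoment_mul_Gamma (m + 2)
  have e3 : (((m + 2 : ℕ) : ℝ) + 3) / 2 = (m + 3) / 2 + 1 := by push_cast; ring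
  have e2 : (((m + 2 : ℕ) : ℝ) + 2) / 2 = (m + 2) / 2 + 1 := by push_cast; ring
  rw [e3, e2, Gamma_add_one (by positivity), Gamma_add_one (by positivity)] at h2
  have hG := Gamma_pos_of_pos (s := ((m : ℝ) + 3) / 2) (by positivity)
  refine mul_right_cancel₀ hG.ne' ?_
  linear_combination 4 * h2 - 2 * (m + 2) * h0

lemma sphereMoment_sq_mul_le (k : ℕ) :
    sphereMoment (2 * k) ^ 2 * (1 + k) ≤ sphereMoment 0 ^ 2 := by
  induction k with
  | zero => simp
  | succ k ih =>
    refine le_trans ?_ ih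
    have h := sphereMoment_add_two (2 * k)
    rw [← eq_div_iff (by positivity)] at h
    rw [mul_add_one, h]
    push_cast
    rw [div_pow, mul_pow, mul_div_assoc, mul_assoc]
    refine mul_le_mul_of_nonneg_left ?_ (sq_nonneg _)
    rw [div_mul_eq_mul_div, div_le_iff₀ (by positivity)]
    have : (0 : ℝ) ≤ k := Nat.cast_nonneg k
    nlinarith

lemma le_sphereMoment_sq_mul (k : ℕ) :
    sphereMoment 0 ^ 2 ≤ sphereMoment (2 * k) ^ 2 * (2 * k + 1) := by
  induction k with
  | zero => simp
  | succ k ih =>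
    refine ih.trans ?_
    have h := sphereMoment_add_two (2 * k)
    rw [← eq_div_iff (by positivity)] at h
    rw [mul_add_one 2 k, h]
    push_cast
    rw [div_pow, mul_pow, mul_div_assoc, mul_assoc]
    refine mul_le_mul_of_nonneg_left ?_ (sq_nonneg _)
    rw [div_mul_eq_mul_div, le_div_iff₀ (by positivity)]
    have : (0 : ℝ) ≤ k := Nat.cast_nonneg k
    nlinarith

lemma norm_psiTilde (k : ℕ) (x : sphere (0 : EuclideanSpace ℝ (Fin 3)) 1) :
    ‖psiTilde k x‖ = axisDist x ^ k := by
  rw [psiTilde, norm_pow, axisDist]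

lemma continuous_psiTilde (k : ℕ) : Continuous (psiTilde k) := by
  unfold psiTilde
  fun_prop

instance : IsFiniteMeasure sphereMeasure := by
  unfold sphereMeasure
  infer_instance

lemma memLp_psiTilde (k : ℕ) (p : ENNReal) : MemLp (psiTilde k) p sphereMeasure :=
  MemLp.of_bound (continuous_psiTilde k).aestronglyMeasurable 1 <| .of_forall fun x => by
    rw [norm_psiTilde]
    exact pow_le_one₀ (axisDist_nonneg x) (axisDist_le_one x)

lemma eLpNorm_two_psiTilde (k : ℕ) :
    eLpNorm (psiTilde k) 2 sphereMeasure = ENNReal.ofReal (sphereMoment (2 * k) ^ (1 / 2 : ℝ)) := by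
  rw [(memLp_psiTilde k 2).eLpNorm_eq_integral_rpow_norm two_ne_zero ENNReal.ofNat_ne_top,
    sphereMoment]
  simp only [norm_psiTilde, ENNReal.toReal_ofNat, rpow_two, ← pow_mul, mul_comm k, one_div]

lemma le_eLpNorm_psiTilde (k : ℕ) {p : ℝ} (hp0 : 0 < p) (hp6 : p ≤ 6) :
    ENNReal.ofReal (sphereMoment (2 * (3 * k)) ^ (1 / p)) ≤
      eLpNorm (psiTilde k) (ENNReal.ofReal p) sphereMeasure := by
  rw [(memLp_psiTilde k _).eLpNorm_eq_integral_rpow_norm (by simpa using hp0)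
    ENNReal.ofReal_ne_top, ENNReal.toReal_ofReal hp0.le, one_div]
  refine ENNReal.ofReal_le_ofReal (rpow_le_rpow (sphereMoment_pos _).le ?_ (by positivity))
  have hint : Integrable (fun x => ‖psiTilde k x‖ ^ p) sphereMeasure := by
    have h := (memLp_psiTilde k (ENNReal.ofReal p)).integrable_norm_rpow (by simpa using hp0)
      ENNReal.ofReal_ne_top
    rwa [ENNReal.toReal_ofReal hp0.le] at h
  refine integral_mono_of_nonneg (.of_forall fun x => pow_nonneg (axisDist_nonneg x) _) hint
    (.of_forall fun x => ?_)
  have h1 : axisDist x ^ k ≤ 1 := pow_le_one₀ (axisDist_nonneg x) (axisDist_le_one x)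
  have h0 : 0 ≤ axisDist x ^ k := pow_nonneg (axisDist_nonneg x) k
  simp only [norm_psiTilde]
  calc axisDist x ^ (2 * (3 * k)) = (axisDist x ^ k) ^ (6 : ℝ) := by
        rw [show (6 : ℝ) = (6 : ℕ) by norm_num, rpow_natCast, ← pow_mul]
        congr 1
        ring
    _ ≤ (axisDist x ^ k) ^ p := rpow_le_rpow_of_exponent_ge_of_imp h0 h1 hp6 (by intros; linarith)

/-- The highest-weight spherical harmonics saturate Sogge's exponent `(p−2)/(4p)`:
for `2 ≤ p ≤ 6` there is `c > 0` with
`‖ψ̃_k‖_{L^p(S²)} ≥ c (1+k)^{(p−2)/(4p)} ‖ψ̃_k‖_{L²(S²)}` for every `k ≥ 1`. -/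
theorem highestWeight_saturates_sogge (p : ℝ) (hp2 : 2 ≤ p) (hp6 : p ≤ 6) :
    ∃ c : ℝ, 0 < c ∧ ∀ k : ℕ, 1 ≤ k →
      ENNReal.ofReal (c * (1 + (k : ℝ)) ^ ((p - 2) / (4 * p))) *
          eLpNorm (psiTilde k) 2 sphereMeasure ≤
        eLpNorm (psiTilde k) (ENNReal.ofReal p) sphereMeasure := by
  have hp0 : 0 < p := by linarith
  set J := sphereMoment 0
  have hJ0 : 0 < J := sphereMoment_pos 0
  refine ⟨(J / √6) ^ (1 / p) / J ^ (1 / 2 : ℝ), by positivity, fun k _ => ?_⟩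
  refine le_trans ?_ (le_eLpNorm_psiTilde k hp0 hp6)
  rw [eLpNorm_two_psiTilde, ← ENNReal.ofReal_mul (by positivity)]
  refine ENNReal.ofReal_le_ofReal ?_
  have hN : (0 : ℝ) < 1 + k := by positivity
  set N : ℝ := 1 + k
  have hup : sphereMoment (2 * k) ≤ J / √N := by
    rw [le_div_iff₀ (by positivity)]
    refine le_of_pow_le_pow_left₀ two_ne_zero hJ0.le ?_
    rw [mul_pow, sq_sqrt hN.le]
    exact sphereMoment_sq_mul_le k
  have hlow : J / √6 / √N ≤ sphereMoment (2 * (3 * k)) := by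
    rw [div_div, div_le_iff₀ (by positivity)]
    refine le_of_pow_le_pow_left₀ two_ne_zero
      (by have := sphereMoment_pos (2 * (3 * k)); positivity) ?_
    rw [mul_pow, mul_pow, sq_sqrt hN.le, sq_sqrt (by norm_num)]
    refine (le_sphereMoment_sq_mul (3 * k)).trans (mul_le_mul_of_nonneg_left ?_ (sq_nonneg _))
    push_cast
    linarith
  have hsqrt (a : ℝ) : √N ^ a = N ^ (a / 2) := by
    rw [sqrt_eq_rpow, ← rpow_mul hN.le]
    congr 1
    ring
  calc (J / √6) ^ (1 / p) / J ^ (1 / 2 : ℝ) * N ^ ((p - 2) / (4 * p)) *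
        sphereMoment (2 * k) ^ (1 / 2 : ℝ)
      ≤ (J / √6) ^ (1 / p) / J ^ (1 / 2 : ℝ) * N ^ ((p - 2) / (4 * p)) *
        (J / √N) ^ (1 / 2 : ℝ) := by
        gcongr
        exact (sphereMoment_pos _).le
    _ = (J / √6 / √N) ^ (1 / p) := by
        rw [div_rpow hJ0.le (sqrt_nonneg N),
          div_rpow (x := J / √6) (by positivity) (sqrt_nonneg N), hsqrt, hsqrt]
        field_simp
        rw [← rpow_add hN]
        congr 1
        field
    _ ≤ sphereMoment (2 * (3 * k)) ^ (1 / p) := by gcongr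
end
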